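/- arXiv:0805.4354 — 3 statements merged into one kernel-verified Lean document; each statement's English description precedes it below -/
import Mathlib

section
/- Let C₁ = C(c₁,r₁,v₁) and C₂ = C(c₂,r₂,v₂) be two distinct round circles in ℝ³ that are disjoint as subsets of ℝ³. Then their orthogonal hemispheres H(c₁,r₁,v₁) and H(c₂,r₂,v₂) in ℝ³ × [0,∞) ⊂ ℝ⁴ intersect in at most one point. -/
noncomputable section

abbrev E3 : Type := EuclideanSpace ℝ (Fin 3)

/-- The round circle in `ℝ³` with center `c`, radius `r` and normal `v`. -/
def circleSet (c : E3) (r : ℝ) (v : E3) : Set E3 :=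
  {x | ‖x - c‖ = r ∧ inner ℝ (x - c) v = (0 : ℝ)}

/-- The orthogonal hemisphere in `ℝ³ × [0,∞)` bounded by the round circle
with center `c`, radius `r` and normal `v`. -/
def hemisphere (c : E3) (r : ℝ) (v : E3) : Set (E3 × ℝ) :=
  {p | 0 ≤ p.2 ∧ ‖p.1 - c‖ ^ 2 + p.2 ^ 2 = r ^ 2 ∧ inner ℝ (p.1 - c) v = (0 : ℝ)}

theorem aux_mem (c v x y : E3) (r s t l : ℝ) (hr : 0 < r)
    (hx : ‖x - c‖ ^ 2 + s ^ 2 = r ^ 2) (hy : ‖y - c‖ ^ 2 + t ^ 2 = r ^ 2)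
    (hxv : inner ℝ (x - c) v = (0 : ℝ)) (hyv : inner ℝ (y - c) v = (0 : ℝ))
    (hl : ‖y - x‖ ^ 2 * (l * l) + (s ^ 2 - t ^ 2 - ‖y - x‖ ^ 2) * l + (- s ^ 2) = 0) :
    x + l • (y - x) ∈ circleSet c r v := by
  have e1 : x + l • (y - x) - c = (x - c) + l • (y - x) := by abel
  have e2 : y - c = (x - c) + (y - x) := by abel
  constructor
  · have h1 := norm_add_sq_real (x - c) (l • (y - x))
    have h2 := norm_add_sq_real (x - c) (y - x)
    rw [← e2] at h2
    rw [← e1, inner_smul_right, norm_smul, mul_pow, Real.norm_eq_abs, sq_abs] at h1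
    have h3 : ‖x + l • (y - x) - c‖ ^ 2 = r ^ 2 := by
      linear_combination h1 - l * h2 + (1 - l) * hx + l * hy + hl
    exact (pow_left_inj₀ (norm_nonneg _) hr.le two_ne_zero).1 h3
  · rw [e2, inner_add_left] at hyv
    rw [e1, inner_add_left, real_inner_smul_left]
    linear_combination (1 - l) * hxv + l * hyv

/-- Two distinct disjoint round circles in `ℝ³` have orthogonal hemispheres meeting
in at most one point. -/
theorem statement0 (c₁ c₂ v₁ v₂ : E3) (r₁ r₂ : ℝ) (hr₁ : 0 < r₁) (hr₂ : 0 < r₂)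
    (hv₁ : ‖v₁‖ = 1) (hv₂ : ‖v₂‖ = 1)
    (hne : circleSet c₁ r₁ v₁ ≠ circleSet c₂ r₂ v₂)
    (hdisj : Disjoint (circleSet c₁ r₁ v₁) (circleSet c₂ r₂ v₂)) :
    (hemisphere c₁ r₁ v₁ ∩ hemisphere c₂ r₂ v₂).Subsingleton := by
  rintro ⟨x, s⟩ ⟨⟨hs, hx1, hxv1⟩, ⟨-, hx2, hxv2⟩⟩ ⟨y, t⟩ ⟨⟨ht, hy1, hyv1⟩, ⟨-, hy2, hyv2⟩⟩
  dsimp only at *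
  by_cases hxy : x = y
  · subst hxy
    have : s = t := (pow_left_inj₀ hs ht two_ne_zero).1 (by linarith)
    rw [this]
  · exfalso
    have hD : 0 < ‖y - x‖ ^ 2 := pow_pos (norm_pos_iff.2 (sub_ne_zero.2 (Ne.symm hxy))) 2
    have hdis : 0 ≤ discrim (‖y - x‖ ^ 2) (s ^ 2 - t ^ 2 - ‖y - x‖ ^ 2) (- s ^ 2) := by
      unfold discrim
      nlinarith [mul_nonneg hD.le (sq_nonneg s), sq_nonneg (s ^ 2 - t ^ 2 - ‖y - x‖ ^ 2)]
    obtain ⟨l, hl⟩ := exists_quadratic_eq_zero hD.ne' ⟨_, (Real.mul_self_sqrt hdis).symm⟩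
    exact Set.disjoint_left.1 hdisj
      (aux_mem c₁ v₁ x y r₁ s t l hr₁ hx1 hy1 hxv1 hyv1 hl)
      (aux_mem c₂ v₂ x y r₂ s t l hr₂ hx2 hy2 hxv2 hyv2 hl)
end
end

section
/- Let C₁ = C(c₁,r₁,v₁) and C₂ = C(c₂,r₂,v₂) be disjoint round circles in ℝ³ whose orthogonal hemispheres H(c₁,r₁,v₁) and H(c₂,r₂,v₂) in ℝ³ × [0,∞) have a common point. Then C₂ meets the spanning disk D(c₁,r₁,v₁) in exactly one point (and symmetrically C₁ meets D(c₂,r₂,v₂) in exactly one point), i.e., C₁ and C₂ are linked. Equivalently, two disjoint unlinked round circles in ℝ³ bound disjoint orthogonal hemispheres in ℝ³ × [0,∞). -/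
noncomputable section

/-- The spanning disk of the round circle with center `c`, radius `r`, normal `v`. -/
def diskSet (c : E3) (r : ℝ) (v : E3) : Set E3 :=
  {x | ‖x - c‖ ≤ r ∧ inner ℝ (x - c) v = (0 : ℝ)}

lemma normsq_line (x c u : E3) (s : ℝ) (hu : ‖u‖ = 1) :
    ‖x + s • u - c‖ ^ 2 = ‖x - c‖ ^ 2 + 2 * s * inner ℝ (x - c) u + s ^ 2 := by
  have h : x + s • u - c = (x - c) + s • u := by abel
  rw [h, norm_add_sq_real, inner_smul_right, norm_smul, hu, mul_one, Real.norm_eq_abs, sq_abs]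
  ring

lemma inner_line (x c u v : E3) (s : ℝ) (h : inner ℝ (x - c) v = (0 : ℝ))
    (hu : inner ℝ u v = (0 : ℝ)) : inner ℝ (x + s • u - c) v = (0 : ℝ) := by
  have e : x + s • u - c = (x - c) + s • u := by abel
  rw [e, inner_add_left, inner_smul_left, h, hu]
  simp

lemma exists_orth (v₁ v₂ : E3) :
    ∃ u : E3, u ≠ 0 ∧ inner ℝ u v₁ = (0 : ℝ) ∧ inner ℝ u v₂ = (0 : ℝ) := by
  let f : E3 →ₗ[ℝ] ℝ × ℝ := ((innerₛₗ ℝ v₁).prod (innerₛₗ ℝ v₂))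
  have hf : LinearMap.ker f ≠ ⊥ := LinearMap.ker_ne_bot_of_finrank_lt (by simp)
  obtain ⟨u, hu, hne⟩ := Submodule.exists_mem_ne_zero_of_ne_bot hf
  have h2 : f u = 0 := hu
  have e1 : inner ℝ v₁ u = (0 : ℝ) := congrArg Prod.fst h2
  have e2 : inner ℝ v₂ u = (0 : ℝ) := congrArg Prod.snd h2
  exact ⟨u, hne, by rw [real_inner_comm]; exact e1, by rw [real_inner_comm]; exact e2⟩

lemma posroot (b t : ℝ) (ht : 0 < t) : ∃ s : ℝ, 0 < s ∧ s ^ 2 + 2 * s * b = t ^ 2 := by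
  have h0 : 0 ≤ b ^ 2 + t ^ 2 := by positivity
  have h1 := Real.sq_sqrt h0
  refine ⟨-b + √(b ^ 2 + t ^ 2), ?_, ?_⟩
  · have : b < √(b ^ 2 + t ^ 2) := by
      apply Real.lt_sqrt_of_sq_lt
      nlinarith
    linarith
  · nlinarith

lemma half (c₁ c₂ v₁ v₂ : E3) (r₁ r₂ : ℝ) (hr₁ : 0 < r₁) (hr₂ : 0 < r₂)
    (hdisj : Disjoint (circleSet c₁ r₁ v₁) (circleSet c₂ r₂ v₂))
    (hmeet : (hemisphere c₁ r₁ v₁ ∩ hemisphere c₂ r₂ v₂).Nonempty) :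
    (∃! x, x ∈ circleSet c₂ r₂ v₂ ∩ diskSet c₁ r₁ v₁) := by
  obtain ⟨⟨x, t⟩, ⟨ht0, h1, p1⟩, ⟨-, h2, p2⟩⟩ := hmeet
  simp only at ht0 h1 p1 h2 p2
  have hdis : ∀ y, ‖y - c₁‖ ^ 2 = r₁ ^ 2 → inner ℝ (y - c₁) v₁ = (0 : ℝ) →
      ‖y - c₂‖ ^ 2 = r₂ ^ 2 → inner ℝ (y - c₂) v₂ = (0 : ℝ) → False := by
    intro y a b c d
    exact Set.disjoint_left.mp hdisj
      ⟨(pow_left_inj₀ (norm_nonneg _) hr₁.le two_ne_zero).mp a, b⟩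
      ⟨(pow_left_inj₀ (norm_nonneg _) hr₂.le two_ne_zero).mp c, d⟩
  have ht : 0 < t := by
    rcases ht0.lt_or_eq with h | h
    · exact h
    · subst h
      exact (hdis x (by linarith) p1 (by linarith) p2).elim
  have key1 : ∀ u : E3, ‖u‖ = 1 → inner ℝ u v₁ = (0 : ℝ) → inner ℝ u v₂ = (0 : ℝ) →
      inner ℝ (x - c₁) u ≠ inner ℝ (x - c₂) u := by
    intro u hu q1 q2 hb
    obtain ⟨s, -, hs⟩ := posroot (inner ℝ (x - c₁) u) t ht
    refine hdis (x + s • u) ?_ (inner_line _ _ _ _ _ p1 q1) ?_ (inner_line _ _ _ _ _ p2 q2)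
    · rw [normsq_line _ _ _ _ hu]; linarith
    · rw [normsq_line _ _ _ _ hu, ← hb]; linarith
  have key2 : ∀ u : E3, u ≠ 0 → inner ℝ u v₁ = (0 : ℝ) → inner ℝ u v₂ = (0 : ℝ) →
      inner ℝ (c₂ - c₁) u ≠ (0 : ℝ) := by
    intro u hu q1 q2 hb
    refine key1 ((‖u‖⁻¹ : ℝ) • u) (norm_smul_inv_norm hu) ?_ ?_ ?_
    · rw [inner_smul_left, q1, mul_zero]
    · rw [inner_smul_left, q2, mul_zero]
    · have e : c₂ - c₁ = (x - c₁) - (x - c₂) := by abel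
      rw [e, inner_sub_left, sub_eq_zero] at hb
      rw [inner_smul_right, inner_smul_right, hb]
  obtain ⟨u, hu, q1, q2, hb⟩ : ∃ u : E3, ‖u‖ = 1 ∧ inner ℝ u v₁ = (0 : ℝ) ∧
      inner ℝ u v₂ = (0 : ℝ) ∧ inner ℝ (x - c₁) u < (inner ℝ (x - c₂) u : ℝ) := by
    obtain ⟨w, hw, a1, a2⟩ := exists_orth v₁ v₂
    have hn : ‖(‖w‖⁻¹ : ℝ) • w‖ = 1 := norm_smul_inv_norm hw
    have b1 : inner ℝ ((‖w‖⁻¹ : ℝ) • w) v₁ = (0 : ℝ) := by rw [inner_smul_left, a1, mul_zero]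
    have b2 : inner ℝ ((‖w‖⁻¹ : ℝ) • w) v₂ = (0 : ℝ) := by rw [inner_smul_left, a2, mul_zero]
    generalize (‖w‖⁻¹ : ℝ) • w = u at hn b1 b2
    rcases lt_or_gt_of_ne (key1 u hn b1 b2) with h | h
    · exact ⟨u, hn, b1, b2, h⟩
    · refine ⟨-u, by rw [norm_neg, hn], by rw [inner_neg_left, b1, neg_zero],
        by rw [inner_neg_left, b2, neg_zero], ?_⟩
      rw [inner_neg_right, inner_neg_right]
      linarith
  have hu0 : u ≠ 0 := by
    rintro rfl
    simp at hu
  have hd := key2 u hu0 q1 q2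
  have span : ∀ y : E3, inner ℝ y v₁ = (0 : ℝ) → inner ℝ y v₂ = (0 : ℝ) →
      ∃ s : ℝ, y = s • u := by
    intro y y1 y2
    have hw : (inner ℝ (c₂ - c₁) y : ℝ) • u - (inner ℝ (c₂ - c₁) u : ℝ) • y = 0 := by
      by_contra hne
      refine key2 _ hne ?_ ?_ ?_
      · rw [inner_sub_left, inner_smul_left, inner_smul_left, q1, y1]; simp
      · rw [inner_sub_left, inner_smul_left, inner_smul_left, q2, y2]; simp
      · rw [inner_sub_right, inner_smul_right, inner_smul_right]; ring
    refine ⟨(inner ℝ (c₂ - c₁) u : ℝ)⁻¹ * (inner ℝ (c₂ - c₁) y : ℝ), ?_⟩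
    rw [mul_smul, sub_eq_zero.mp hw, smul_smul, inv_mul_cancel₀ hd, one_smul]
  obtain ⟨s, hs, hs2⟩ := posroot (inner ℝ (x - c₂) u) t ht
  refine ⟨x + s • u, ⟨⟨?_, inner_line _ _ _ _ _ p2 q2⟩, ⟨?_, inner_line _ _ _ _ _ p1 q1⟩⟩, ?_⟩
  · rw [← pow_left_inj₀ (norm_nonneg _) hr₂.le two_ne_zero, normsq_line _ _ _ _ hu]
    linarith
  · rw [← pow_le_pow_iff_left₀ (norm_nonneg _) hr₁.le two_ne_zero, normsq_line _ _ _ _ hu]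
    nlinarith [mul_pos hs (sub_pos.mpr hb)]
  · rintro y ⟨⟨g1, g2⟩, ⟨g3, g4⟩⟩
    obtain ⟨s', e⟩ := span (y - x)
      (by rw [show y - x = (y - c₁) - (x - c₁) by abel, inner_sub_left, g4, p1, sub_zero])
      (by rw [show y - x = (y - c₂) - (x - c₂) by abel, inner_sub_left, g2, p2, sub_zero])
    have ey : y = x + s' • u := by rw [← e]; abel
    subst ey
    rw [← pow_left_inj₀ (norm_nonneg _) hr₂.le two_ne_zero, normsq_line _ _ _ _ hu] at g1
    rw [← pow_le_pow_iff_left₀ (norm_nonneg _) hr₁.le two_ne_zero, normsq_line _ _ _ _ hu] at g3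
    generalize (inner ℝ (x - c₁) u : ℝ) = b₁ at *
    generalize (inner ℝ (x - c₂) u : ℝ) = b₂ at *
    have k1 : s' ^ 2 + 2 * s' * b₂ = t ^ 2 := by linarith
    have k2 : 0 ≤ s' := by
      by_contra hneg
      push Not at hneg
      nlinarith [mul_pos (neg_pos.mpr hneg) (sub_pos.mpr hb)]
    have k3 : 0 < s + 2 * b₂ := by
      by_contra hneg
      push Not at hneg
      nlinarith [mul_nonneg hs.le (neg_nonneg.mpr hneg), pow_pos ht 2]
    have k4 : (s' - s) * (s' + (s + 2 * b₂)) = 0 := by linarith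
    rcases mul_eq_zero.mp k4 with h | h
    · rw [sub_eq_zero.mp h]
    · linarith

/-- If two disjoint round circles have orthogonal hemispheres with a common point, then each
circle meets the spanning disk of the other in exactly one point, i.e. the circles are linked.
Equivalently, disjoint unlinked round circles bound disjoint orthogonal hemispheres. -/
theorem statement1 (c₁ c₂ v₁ v₂ : E3) (r₁ r₂ : ℝ) (hr₁ : 0 < r₁) (hr₂ : 0 < r₂)
    (hv₁ : ‖v₁‖ = 1) (hv₂ : ‖v₂‖ = 1)
    (hdisj : Disjoint (circleSet c₁ r₁ v₁) (circleSet c₂ r₂ v₂))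
    (hmeet : (hemisphere c₁ r₁ v₁ ∩ hemisphere c₂ r₂ v₂).Nonempty) :
    (∃! x, x ∈ circleSet c₂ r₂ v₂ ∩ diskSet c₁ r₁ v₁) ∧
    (∃! x, x ∈ circleSet c₁ r₁ v₁ ∩ diskSet c₂ r₂ v₂) := by
  exact ⟨half c₁ c₂ v₁ v₂ r₁ r₂ hr₁ hr₂ hdisj hmeet,
    half c₂ c₁ v₂ v₁ r₂ r₁ hr₂ hr₁ hdisj.symm (by rwa [Set.inter_comm])⟩
end
end

section
/- Let 𝒰𝒲^σ_n ⊂ 𝒰𝒲_n be the subspace of configurations whose wickets have pairwise disjoint orthogonal projections to the xy-plane, and let 𝒰𝒲^ρ_n ⊂ 𝒰𝒲_n be the subspace of configurations each of whose wickets is invariant under reflection across the xz-plane. Then: (1) the map 𝒰𝒲^σ_n → 𝒞_n sending each wicket to its endpoint of larger y-coordinate is a homotopy equivalence; (2) 𝒰𝒲^ρ_n is homeomorphic to the unordered configuration space of n points in the open upper half-plane; and (3) the inclusions 𝒰𝒲^σ_n ↪ 𝒰𝒲_n and 𝒰𝒲^ρ_n ↪ 𝒰𝒲_n both induce injective homomorphisms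 on fundamental groups, so that π₁𝒰𝒲_n contains two subgroups isomorphic to the braid group B_n (generated by the σ_i's and by the ρ_i's respectively). -/
noncomputable section

open CategoryTheory

abbrev E2 : Type := EuclideanSpace ℝ (Fin 2)
/-- The point of `ℝ³` with the given coordinates. -/
def e3mk (x y z : ℝ) : E3 := (WithLp.equiv 2 (Fin 3 → ℝ)).symm ![x, y, z]

/-- The wicket with endpoints `a, b ∈ ℝ²`: the semicircle in upper half-space lying in
the vertical plane through `(a,0)` and `(b,0)`, with center `m = ((a+b)/2, 0)` and
radius `‖a-b‖/2`. -/
def wicket (a b : E2) : Set E3 :=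
  {x | 0 ≤ x 2 ∧ dist x (e3mk ((a 0 + b 0) / 2) ((a 1 + b 1) / 2) 0) = dist a b / 2 ∧
    ∃ t : ℝ, x 0 = a 0 + t * (b 0 - a 0) ∧ x 1 = a 1 + t * (b 1 - a 1)}

/-- An `n`-tuple of endpoint pairs of pairwise disjoint wickets. -/
def IsWicketTuple {n : ℕ} (f : Fin n → E2 × E2) : Prop :=
  (∀ i, (f i).1 ≠ (f i).2) ∧
  (∀ i j, i ≠ j → Disjoint (wicket (f i).1 (f i).2) (wicket (f j).1 (f j).2))

/-- The space of ordered `n`-tuples of pairwise disjoint wickets. -/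
abbrev WicketTuple (n : ℕ) : Type := {f : Fin n → E2 × E2 // IsWicketTuple f}

/-- Two tuples are identified iff they determine the same `n`-element set of wickets
(this permutes the wickets and swaps endpoints). -/
def wicketSetoid (n : ℕ) : Setoid (WicketTuple n) where
  r f g := (Set.range fun i => wicket (f.1 i).1 (f.1 i).2) =
    Set.range fun i => wicket (g.1 i).1 (g.1 i).2
  iseqv := ⟨fun _ => rfl, Eq.symm, Eq.trans⟩

/-- The wicket space `𝒲_n`: configurations of `n` disjoint wickets, with the quotient
topology. -/
abbrev WConf (n : ℕ) : Type := Quotient (wicketSetoid n)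

/-- All wickets of the tuple lie in planes perpendicular to the `x`-axis: both endpoints
of each wicket have the same `x`-coordinate. -/
def IsUWTuple {n : ℕ} (f : WicketTuple n) : Prop := ∀ i, (f.1 i).1 0 = (f.1 i).2 0

/-- The untwisted wicket space `𝒰𝒲_n ⊆ 𝒲_n`. -/
def UWConf (n : ℕ) : Set (WConf n) :=
  {x | ∃ f, Quotient.mk (wicketSetoid n) f = x ∧ IsUWTuple f}

/-- Ordered tuples of `k` distinct points in the plane. -/
abbrev PtTuple (k : ℕ) : Type := {f : Fin k → E2 // Function.Injective f}

/-- Two tuples of points are identified iff they have the same underlying set. -/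
def ptSetoid (k : ℕ) : Setoid (PtTuple k) where
  r f g := Set.range f.1 = Set.range g.1
  iseqv := ⟨fun _ => rfl, Eq.symm, Eq.trans⟩

/-- The unordered configuration space `𝒞_k` of `k` distinct points in `ℝ²`, whose
fundamental group is the braid group `B_k`. -/
abbrev CConf (k : ℕ) : Type := Quotient (ptSetoid k)

/-- The homomorphism on fundamental groups induced by a continuous map. -/
def pi1Map {X Y : Type} [TopologicalSpace X] [TopologicalSpace Y] (f : C(X, Y)) (x : X) :
    Aut (FundamentalGroupoid.mk x) →* Aut (FundamentalGroupoid.mk (f x)) :=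
  CategoryTheory.Functor.mapAut (FundamentalGroupoid.mk x)
    (FundamentalGroupoid.fundamentalGroupoidFunctor.map
      (show TopCat.of X ⟶ TopCat.of Y from TopCat.ofHom f))

/-- The wickets of the tuple have pairwise disjoint orthogonal projections to the
`xy`-plane (the projection of a wicket being the segment between its endpoints). -/
def IsSigmaTuple {n : ℕ} (f : WicketTuple n) : Prop :=
  IsUWTuple f ∧ ∀ i j, i ≠ j →
    Disjoint (segment ℝ (f.1 i).1 (f.1 i).2) (segment ℝ (f.1 j).1 (f.1 j).2)

/-- The subspace `𝒰𝒲^σ_n ⊆ 𝒰𝒲_n` of configurations of wickets with pairwise disjoint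
projections to the `xy`-plane. -/
def SigmaConf (n : ℕ) : Set (WConf n) :=
  {x | ∃ f, Quotient.mk (wicketSetoid n) f = x ∧ IsSigmaTuple f}

/-- Reflection of `ℝ³` across the `xz`-plane. -/
def reflXZ : E3 → E3 := fun x => e3mk (x 0) (-(x 1)) (x 2)

/-- Each wicket of the tuple is invariant under reflection across the `xz`-plane. -/
def IsRhoTuple {n : ℕ} (f : WicketTuple n) : Prop :=
  IsUWTuple f ∧ ∀ i, reflXZ '' wicket (f.1 i).1 (f.1 i).2 = wicket (f.1 i).1 (f.1 i).2

/-- The subspace `𝒰𝒲^ρ_n ⊆ 𝒰𝒲_n` of configurations of wickets symmetric with respect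
to reflection across the `xz`-plane. -/
def RhoConf (n : ℕ) : Set (WConf n) :=
  {x | ∃ f, Quotient.mk (wicketSetoid n) f = x ∧ IsRhoTuple f}

/-- The open upper half-plane. -/
abbrev UHP : Type := {a : E2 // 0 < a 1}

/-- Ordered tuples of `n` distinct points in the open upper half-plane. -/
abbrev HPtTuple (n : ℕ) : Type := {f : Fin n → UHP // Function.Injective f}

def hptSetoid (n : ℕ) : Setoid (HPtTuple n) where
  r f g := Set.range f.1 = Set.range g.1
  iseqv := ⟨fun _ => rfl, Eq.symm, Eq.trans⟩

/-- The unordered configuration space of `n` distinct points in the open upper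
half-plane. -/
abbrev HConf (n : ℕ) : Type := Quotient (hptSetoid n)

lemma Sigma_subset_UW (n : ℕ) : SigmaConf n ⊆ UWConf n := by
  rintro x ⟨f, hf, hs⟩
  exact ⟨f, hf, hs.1⟩

lemma Rho_subset_UW (n : ℕ) : RhoConf n ⊆ UWConf n := by
  rintro x ⟨f, hf, hs⟩
  exact ⟨f, hf, hs.1⟩

/-- The inclusion `𝒰𝒲^σ_n ↪ 𝒰𝒲_n`. -/
def inclSigma (n : ℕ) : C(↥(SigmaConf n), ↥(UWConf n)) :=
  ⟨Set.inclusion (Sigma_subset_UW n), continuous_inclusion (Sigma_subset_UW n)⟩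

/-- The inclusion `𝒰𝒲^ρ_n ↪ 𝒰𝒲_n`. -/
def inclRho (n : ℕ) : C(↥(RhoConf n), ↥(UWConf n)) :=
  ⟨Set.inclusion (Rho_subset_UW n), continuous_inclusion (Rho_subset_UW n)⟩

/-! ### Injectivity on fundamental groups from a left homotopy inverse -/

lemma pi1Map_injective_of_homotopic {X Y : Type} [TopologicalSpace X] [TopologicalSpace Y]
    (f : C(X, Y)) (g : C(Y, X)) (H : (g.comp f).Homotopic (ContinuousMap.id X)) (x : X) :
    Function.Injective (pi1Map f x) := by
  obtain ⟨H⟩ := H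
  have hF : (FundamentalGroupoid.map f ⋙ FundamentalGroupoid.map g).Faithful := by
    have e := (asIso (FundamentalGroupoidFunctor.homotopicMapsNatIso H)).symm
    rw [FundamentalGroupoid.map_id, FundamentalGroupoid.map_comp] at e
    exact CategoryTheory.Functor.Faithful.of_iso e
  have hF' : (FundamentalGroupoid.map f).Faithful :=
    CategoryTheory.Functor.Faithful.of_comp _ (FundamentalGroupoid.map g)
  intro a b hab
  have h1 : (FundamentalGroupoid.map f).map a.hom = (FundamentalGroupoid.map f).map b.hom :=
    congrArg (fun c => c.hom) hab
  exact CategoryTheory.Iso.ext ((FundamentalGroupoid.map f).map_injective h1)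

/-! ### Geometry of wickets -/

def mk2 (x y : ℝ) : E2 := !₂[x, y]

@[simp] lemma mk2_zero (x y : ℝ) : mk2 x y 0 = x := rfl
@[simp] lemma mk2_one (x y : ℝ) : mk2 x y 1 = y := rfl
@[simp] lemma e3mk_zero (x y z : ℝ) : e3mk x y z 0 = x := rfl
@[simp] lemma e3mk_one (x y z : ℝ) : e3mk x y z 1 = y := rfl
@[simp] lemma e3mk_two (x y z : ℝ) : e3mk x y z 2 = z := rfl

lemma E2_ext {a b : E2} (h0 : a 0 = b 0) (h1 : a 1 = b 1) : a = b := by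
  ext i; fin_cases i <;> assumption

lemma E3_ext {a b : E3} (h0 : a 0 = b 0) (h1 : a 1 = b 1) (h2 : a 2 = b 2) : a = b := by
  ext i; fin_cases i <;> assumption

lemma continuous_mk2 {X : Type*} [TopologicalSpace X] {u v : X → ℝ} (hu : Continuous u)
    (hv : Continuous v) : Continuous fun x => mk2 (u x) (v x) := by
  unfold mk2
  refine (PiLp.continuous_toLp 2 _).comp ?_
  refine continuous_pi fun i => ?_
  fin_cases i
  · exact hu
  · exact hv

lemma mem_wicket_iff (a b : E2) (x : E3) : x ∈ wicket a b ↔ 0 ≤ x 2 ∧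
    ((x 0 - (a 0 + b 0) / 2) ^ 2 + (x 1 - (a 1 + b 1) / 2) ^ 2 + (x 2) ^ 2
      = ((a 0 - b 0) ^ 2 + (a 1 - b 1) ^ 2) / 4) ∧
    ∃ t : ℝ, x 0 = a 0 + t * (b 0 - a 0) ∧ x 1 = a 1 + t * (b 1 - a 1) := by
  unfold wicket
  simp only [Set.mem_ofPred_eq]
  refine and_congr_right fun _ => and_congr_left fun _ => ?_
  rw [EuclideanSpace.dist_eq, EuclideanSpace.dist_eq, Fin.sum_univ_three, Fin.sum_univ_two]
  simp only [Real.dist_eq, sq_abs, e3mk_zero, e3mk_one, e3mk_two, sub_zero]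
  constructor
  · intro h
    have h2 := congrArg (fun z => z ^ 2) h
    simp only [div_pow] at h2
    rw [Real.sq_sqrt (by positivity), Real.sq_sqrt (by positivity)] at h2
    linarith
  · intro h
    rw [h, Real.sqrt_div (by positivity)]
    congr 1
    rw [show (4 : ℝ) = 2 ^ 2 by norm_num, Real.sqrt_sq (by norm_num)]

lemma wicket_comm (a b : E2) : wicket a b = wicket b a := by
  have key : ∀ a b : E2, wicket a b ⊆ wicket b a := by
    intro a b x
    rw [mem_wicket_iff, mem_wicket_iff]
    rintro ⟨h, h', t, h1, h2⟩
    refine ⟨h, by linarith [h', add_comm (a 0) (b 0), show (x 0 - (b 0 + a 0) / 2) ^ 2 = (x 0 - (a 0 + b 0) / 2) ^ 2 by ring, show (x 1 - (b 1 + a 1) / 2) ^ 2 = (x 1 - (a 1 + b 1) / 2) ^ 2 by ring], 1 - t, ?_, ?_⟩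
    · rw [h1]; ring
    · rw [h2]; ring
  exact Set.Subset.antisymm (key a b) (key b a)

lemma left_mem_wicket (a b : E2) : e3mk (a 0) (a 1) 0 ∈ wicket a b := by
  rw [mem_wicket_iff]
  refine ⟨by simp, ?_, 0, by simp, by simp⟩
  simp; ring

lemma right_mem_wicket (a b : E2) : e3mk (b 0) (b 1) 0 ∈ wicket a b := by
  rw [wicket_comm]; exact left_mem_wicket b a

lemma eq_of_floor_mem {a b p : E2} (h : e3mk (p 0) (p 1) 0 ∈ wicket a b) : p = a ∨ p = b := by
  rw [mem_wicket_iff] at h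
  obtain ⟨-, h, t, h0, h1⟩ := h
  simp only [e3mk_zero, e3mk_one, e3mk_two] at h h0 h1
  rw [h0, h1] at h
  have h2 : (t * (t - 1)) * ((a 0 - b 0) ^ 2 + (a 1 - b 1) ^ 2) = 0 := by linarith
  rcases mul_eq_zero.1 h2 with h3 | h3
  · rcases mul_eq_zero.1 h3 with h4 | h4
    · left; subst h4; exact E2_ext (by linarith) (by linarith)
    · right; obtain rfl : t = 1 := by linarith
      exact E2_ext (by linarith) (by linarith)
  · have e0 : a 0 - b 0 = 0 := by nlinarith [sq_nonneg (a 0 - b 0), sq_nonneg (a 1 - b 1)]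
    have e1 : a 1 - b 1 = 0 := by nlinarith [sq_nonneg (a 0 - b 0), sq_nonneg (a 1 - b 1)]
    left
    refine E2_ext ?_ ?_
    · rw [h0]; linear_combination -t * e0
    · rw [h1]; linear_combination -t * e1

lemma wicket_inj {a b c d : E2} (hab : a ≠ b) (h : wicket a b = wicket c d) :
    (a, b) = (c, d) ∨ (a, b) = (d, c) := by
  have ha := eq_of_floor_mem (h ▸ left_mem_wicket a b)
  have hb := eq_of_floor_mem (h ▸ right_mem_wicket a b)
  rcases ha with rfl | rfl <;> rcases hb with rfl | rfl <;> simp_all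

/-! ### The quotient map on wicket tuples -/

lemma wicket_injective {n : ℕ} (f : WicketTuple n) :
    Function.Injective fun i => wicket (f.1 i).1 (f.1 i).2 := by
  intro i j hij
  by_contra hne
  have hd := f.2.2 i j hne
  simp only at hij
  rw [← hij] at hd
  exact Set.disjoint_left.1 hd (left_mem_wicket _ _) (left_mem_wicket _ _)

lemma exists_perm {ι α : Type*} {u v : ι → α} (hu : Function.Injective u)
    (hv : Function.Injective v) (h : Set.range u = Set.range v) :
    ∃ σ : Equiv.Perm ι, ∀ i, v i = u (σ i) := by
  refine ⟨(Equiv.ofInjective v hv).trans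
    ((Equiv.setCongr h.symm).trans (Equiv.ofInjective u hu).symm), fun i => ?_⟩
  simp only [Equiv.trans_apply]
  rw [Equiv.apply_ofInjective_symm hu]
  rfl

lemma rel_perm {n : ℕ} {f g : WicketTuple n}
    (h : Quotient.mk (wicketSetoid n) f = Quotient.mk (wicketSetoid n) g) :
    ∃ σ : Equiv.Perm (Fin n), ∀ i, g.1 i = f.1 (σ i) ∨ g.1 i = (f.1 (σ i)).swap := by
  have h' : (Set.range fun i => wicket (f.1 i).1 (f.1 i).2) =
    Set.range fun i => wicket (g.1 i).1 (g.1 i).2 := Quotient.exact h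
  obtain ⟨σ, hσ⟩ := exists_perm (wicket_injective f) (wicket_injective g) h'
  exact ⟨σ, fun i => wicket_inj (g.2.1 i) (hσ i)⟩

lemma rel_of_perm {n : ℕ} {f g : WicketTuple n} (σ : Equiv.Perm (Fin n))
    (h : ∀ i, g.1 i = f.1 (σ i) ∨ g.1 i = (f.1 (σ i)).swap) :
    Quotient.mk (wicketSetoid n) f = Quotient.mk (wicketSetoid n) g := by
  apply Quotient.sound
  change (Set.range fun i => wicket (f.1 i).1 (f.1 i).2) =
    Set.range fun i => wicket (g.1 i).1 (g.1 i).2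
  rw [← σ.surjective.range_comp]
  congr 1
  funext i
  rcases h i with h | h
  · simp [h]
  · simp only [h, Function.comp, Prod.fst_swap, Prod.snd_swap]
    exact wicket_comm _ _

/-- The action of permutations and swaps on tuples of wickets. -/
def wact {n : ℕ} (σ : Equiv.Perm (Fin n)) (s : Fin n → Bool) (f : WicketTuple n) :
    WicketTuple n :=
  ⟨fun i => bif s i then (f.1 (σ i)).swap else f.1 (σ i), by
    have hw : ∀ i, wicket ((bif s i then (f.1 (σ i)).swap else f.1 (σ i))).1
        ((bif s i then (f.1 (σ i)).swap else f.1 (σ i))).2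
        = wicket (f.1 (σ i)).1 (f.1 (σ i)).2 := by
      intro i
      cases s i
      · rfl
      · exact wicket_comm _ _
    refine ⟨fun i => ?_, fun i j hij => ?_⟩
    · change (bif s i then (f.1 (σ i)).swap else f.1 (σ i)).1 ≠
        (bif s i then (f.1 (σ i)).swap else f.1 (σ i)).2
      cases s i
      · exact f.2.1 (σ i)
      · exact (f.2.1 (σ i)).symm
    · simp only [hw]
      exact f.2.2 _ _ (fun h => hij (σ.injective h))⟩

lemma continuous_wact {n : ℕ} (σ : Equiv.Perm (Fin n)) (s : Fin n → Bool) :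
    Continuous (wact (n := n) σ s) := by
  refine Continuous.subtype_mk (continuous_pi fun i => ?_) _
  cases s i
  · exact (continuous_apply _).comp continuous_subtype_val
  · exact continuous_swap.comp ((continuous_apply _).comp continuous_subtype_val)

lemma isOpenQuotientMap_mk (n : ℕ) : IsOpenQuotientMap (Quotient.mk (wicketSetoid n)) := by
  refine ⟨Quotient.mk_surjective, continuous_quotient_mk', fun U hU => ?_⟩
  rw [← isQuotientMap_quotient_mk'.isOpen_preimage]
  have : (Quotient.mk (wicketSetoid n)) ⁻¹' (Quotient.mk (wicketSetoid n) '' U) =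
      ⋃ σ : Equiv.Perm (Fin n), ⋃ s : Fin n → Bool, wact σ s ⁻¹' U := by
    ext g
    simp only [Set.mem_preimage, Set.mem_image, Set.mem_iUnion]
    constructor
    · rintro ⟨f, hf, hfg⟩
      obtain ⟨σ, hσ⟩ := rel_perm hfg.symm
      classical
      refine ⟨σ, fun i => decide (¬ f.1 i = g.1 (σ i)), ?_⟩
      convert hf
      apply Subtype.ext
      funext i
      by_cases h : f.1 i = g.1 (σ i)
      · simp [wact, h]
      · have := (hσ i).resolve_left h
        have h' : ¬ (g.1 (σ i)).swap = g.1 (σ i) := by rwa [this] at h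
        simp [wact, this, h']
    · rintro ⟨σ, s, h⟩
      refine ⟨_, h, ?_⟩
      refine (rel_of_perm σ fun i => ?_).symm
      cases hs : s i
      · left; simp [wact, hs]
      · right; simp [wact, hs]
  change IsOpen ((Quotient.mk (wicketSetoid n)) ⁻¹' (Quotient.mk (wicketSetoid n) '' U))
  rw [this]
  exact isOpen_iUnion fun σ => isOpen_iUnion fun s => hU.preimage (continuous_wact σ s)

/-- Maps out of (a parameter space times) a subspace of the wicket space. -/
lemma exists_lift {n : ℕ} (S : Set (WConf n)) {K Z : Type*} [TopologicalSpace K]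
    [TopologicalSpace Z]
    (Φ : K × (Quotient.mk (wicketSetoid n) ⁻¹' S) → Z) (hΦ : Continuous Φ)
    (hinv : ∀ k f g, Quotient.mk (wicketSetoid n) f.1 = Quotient.mk (wicketSetoid n) g.1 →
      Φ (k, f) = Φ (k, g)) :
    ∃ Ψ : C(K × S, Z), ∀ k f, Ψ (k, ⟨Quotient.mk (wicketSetoid n) f.1, f.2⟩) = Φ (k, f) := by
  have hq : IsOpenQuotientMap (Prod.map (id : K → K)
      (S.restrictPreimage (Quotient.mk (wicketSetoid n)))) :=
    IsOpenQuotientMap.id.prodMap ((isOpenQuotientMap_mk n).restrictPreimage S)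
  have key : ∀ p, Φ (Function.surjInv hq.surjective (Prod.map id
      (S.restrictPreimage (Quotient.mk (wicketSetoid n))) p)) = Φ p := by
    rintro ⟨k, f⟩
    have h := Function.surjInv_eq hq.surjective (Prod.map id
      (S.restrictPreimage (Quotient.mk (wicketSetoid n))) (k, f))
    generalize Function.surjInv hq.surjective (Prod.map id
      (S.restrictPreimage (Quotient.mk (wicketSetoid n))) (k, f)) = p at h ⊢
    obtain ⟨k', g⟩ := p
    simp only [Prod.map, id, Prod.mk.injEq] at h
    obtain ⟨rfl, h⟩ := h
    exact hinv _ g f (congrArg Subtype.val h)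
  refine ⟨⟨fun p => Φ (Function.surjInv hq.surjective p), ?_⟩, fun k f => key (k, f)⟩
  rw [hq.isQuotientMap.continuous_iff]
  exact hΦ.congr fun p => (key p).symm

lemma exists_lift' {n : ℕ} (S : Set (WConf n)) {Z : Type*} [TopologicalSpace Z]
    (Φ : (Quotient.mk (wicketSetoid n) ⁻¹' S) → Z) (hΦ : Continuous Φ)
    (hinv : ∀ f g, Quotient.mk (wicketSetoid n) f.1 = Quotient.mk (wicketSetoid n) g.1 →
      Φ f = Φ g) :
    ∃ Ψ : C(S, Z), ∀ f, Ψ ⟨Quotient.mk (wicketSetoid n) f.1, f.2⟩ = Φ f := by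
  obtain ⟨Ψ, h⟩ := exists_lift S (K := Unit) (fun p => Φ p.2) (hΦ.comp continuous_snd)
    (fun _ f g h => hinv f g h)
  exact ⟨Ψ.comp ⟨fun x => ((), x), by fun_prop⟩, fun f => h () f⟩

/-! ### Tops and lengths of untwisted wickets -/

/-- The endpoint with larger `y`-coordinate. -/
def topPt (e : E2 × E2) : E2 := mk2 (e.1 0) (max (e.1 1) (e.2 1))

def wlen (e : E2 × E2) : ℝ := |e.1 1 - e.2 1|

lemma continuous_topPt : Continuous topPt := by
  unfold topPt
  refine continuous_mk2 ?_ ?_ <;> fun_prop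

lemma continuous_wlen : Continuous wlen := by
  unfold wlen
  fun_prop

lemma topPt_swap {e : E2 × E2} (h : e.1 0 = e.2 0) : topPt e.swap = topPt e := by
  simp [topPt, h, max_comm]

lemma wlen_swap (e : E2 × E2) : wlen e.swap = wlen e := by
  simp [wlen, abs_sub_comm]

lemma ne_one_of_uw {e : E2 × E2} (h : e.1 0 = e.2 0) (hne : e.1 ≠ e.2) : e.1 1 ≠ e.2 1 :=
  fun h1 => hne (E2_ext h h1)

lemma wlen_pos {e : E2 × E2} (h : e.1 0 = e.2 0) (hne : e.1 ≠ e.2) : 0 < wlen e :=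
  abs_pos.2 (sub_ne_zero.2 (ne_one_of_uw h hne))

lemma topPt_eq_ite {e : E2 × E2} (h : e.1 0 = e.2 0) :
    topPt e = if e.2 1 < e.1 1 then e.1 else e.2 := by
  split_ifs with h1
  · exact E2_ext rfl (max_eq_left h1.le)
  · exact E2_ext h (max_eq_right (not_lt.1 h1))

lemma topPt_mem {e : E2 × E2} (h : e.1 0 = e.2 0) : topPt e = e.1 ∨ topPt e = e.2 := by
  rw [topPt_eq_ite h]; split_ifs <;> simp

/-- The vertical pair with given top and length. -/
def vpair (p : E2) (l : ℝ) : E2 × E2 := (p, mk2 (p 0) (p 1 - l))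

lemma pair_nf {e : E2 × E2} (h : e.1 0 = e.2 0) :
    e = vpair (topPt e) (wlen e) ∨ e = (vpair (topPt e) (wlen e)).swap := by
  rcases le_total (e.1 1) (e.2 1) with h1 | h1
  · right
    refine Prod.ext (E2_ext rfl ?_) (E2_ext h.symm ?_)
    · simp [vpair, topPt, wlen, max_eq_right h1, abs_of_nonpos (sub_nonpos.2 h1)]
    · simp [vpair, topPt, max_eq_right h1]
  · left
    refine Prod.ext (E2_ext rfl ?_) (E2_ext h.symm ?_)
    · simp [vpair, topPt, max_eq_left h1]
    · simp [vpair, topPt, wlen, max_eq_left h1, abs_of_nonneg (sub_nonneg.2 h1)]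

lemma topPt_vpair {p : E2} {l : ℝ} (hl : 0 ≤ l) : topPt (vpair p l) = p := by
  refine E2_ext rfl ?_
  simp [topPt, vpair, hl]

lemma wlen_vpair {p : E2} {l : ℝ} (hl : 0 ≤ l) : wlen (vpair p l) = l := by
  simp [wlen, vpair, abs_of_nonneg hl]

lemma mem_segment_vpair {p q : E2} {l : ℝ} (hl : 0 < l) :
    q ∈ segment ℝ (vpair p l).1 (vpair p l).2 ↔ q 0 = p 0 ∧ p 1 - l ≤ q 1 ∧ q 1 ≤ p 1 := by
  rw [segment_eq_image']
  simp only [Set.mem_image, vpair]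
  constructor
  · rintro ⟨t, ⟨ht0, ht1⟩, rfl⟩
    simp
    constructor <;> nlinarith
  · rintro ⟨h0, h1, h2⟩
    refine ⟨(p 1 - q 1) / l, ⟨by apply div_nonneg <;> linarith, ?_⟩, ?_⟩
    · rw [div_le_one hl]; linarith
    · refine E2_ext ?_ ?_
      · simp [h0]
      · simp
        field_simp
        ring

lemma proj_mem_segment {a b : E2} (hab : a ≠ b) {z : E3} (hz : z ∈ wicket a b) :
    mk2 (z 0) (z 1) ∈ segment ℝ a b := by
  rw [mem_wicket_iff] at hz
  obtain ⟨h2, h, t, h0, h1⟩ := hz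
  rw [h0, h1] at h
  have hD : 0 < (a 0 - b 0) ^ 2 + (a 1 - b 1) ^ 2 := by
    by_contra hn
    have e0 : a 0 - b 0 = 0 := by nlinarith [sq_nonneg (a 0 - b 0), sq_nonneg (a 1 - b 1)]
    have e1 : a 1 - b 1 = 0 := by nlinarith [sq_nonneg (a 0 - b 0), sq_nonneg (a 1 - b 1)]
    exact hab (E2_ext (by linarith) (by linarith))
  have ht : (t * (t - 1)) * ((a 0 - b 0) ^ 2 + (a 1 - b 1) ^ 2) ≤ 0 := by
    nlinarith [sq_nonneg (z 2)]
  have ht' : t * (t - 1) ≤ 0 := by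
    by_contra hn
    exact absurd ht (not_le.2 (mul_pos (not_le.1 hn) hD))
  rw [segment_eq_image']
  refine ⟨t, ⟨by nlinarith, by nlinarith⟩, ?_⟩
  refine E2_ext ?_ ?_
  · simp [h0]
  · simp [h1]

/-! ### Saturation of the subspaces -/

lemma uw_of_rel {n : ℕ} {f g : WicketTuple n}
    (h : Quotient.mk (wicketSetoid n) f = Quotient.mk (wicketSetoid n) g) (hf : IsUWTuple f) :
    IsUWTuple g := by
  obtain ⟨σ, hσ⟩ := rel_perm h
  intro i
  rcases hσ i with e | e <;> rw [e]
  · exact hf _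
  · exact (hf _).symm

lemma sigma_of_rel {n : ℕ} {f g : WicketTuple n}
    (h : Quotient.mk (wicketSetoid n) f = Quotient.mk (wicketSetoid n) g)
    (hf : IsSigmaTuple f) : IsSigmaTuple g := by
  refine ⟨uw_of_rel h hf.1, fun i j hij => ?_⟩
  obtain ⟨σ, hσ⟩ := rel_perm h
  have hs : ∀ i, segment ℝ (g.1 i).1 (g.1 i).2 = segment ℝ (f.1 (σ i)).1 (f.1 (σ i)).2 := by
    intro i
    rcases hσ i with e | e <;> rw [e]
    exact segment_symm _ _ _
  rw [hs, hs]
  exact hf.2 _ _ fun e => hij (σ.injective e)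

lemma rho_of_rel {n : ℕ} {f g : WicketTuple n}
    (h : Quotient.mk (wicketSetoid n) f = Quotient.mk (wicketSetoid n) g)
    (hf : IsRhoTuple f) : IsRhoTuple g := by
  refine ⟨uw_of_rel h hf.1, fun i => ?_⟩
  obtain ⟨σ, hσ⟩ := rel_perm h
  have hs : wicket (g.1 i).1 (g.1 i).2 = wicket (f.1 (σ i)).1 (f.1 (σ i)).2 := by
    rcases hσ i with e | e <;> rw [e]
    exact wicket_comm _ _
  rw [hs]
  exact hf.2 _

lemma uw_of_mem {n : ℕ} {f : WicketTuple n}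
    (h : Quotient.mk (wicketSetoid n) f ∈ UWConf n) : IsUWTuple f := by
  obtain ⟨g, hg, hu⟩ := h
  exact uw_of_rel hg hu

lemma sigma_of_mem {n : ℕ} {f : WicketTuple n}
    (h : Quotient.mk (wicketSetoid n) f ∈ SigmaConf n) : IsSigmaTuple f := by
  obtain ⟨g, hg, hu⟩ := h
  exact sigma_of_rel hg hu

lemma rho_of_mem {n : ℕ} {f : WicketTuple n}
    (h : Quotient.mk (wicketSetoid n) f ∈ RhoConf n) : IsRhoTuple f := by
  obtain ⟨g, hg, hu⟩ := h
  exact rho_of_rel hg hu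

/-- The tuple of tops of a tuple of wickets. -/
def tops {n : ℕ} (f : WicketTuple n) : Fin n → E2 := fun i => topPt (f.1 i)

def wlens {n : ℕ} (f : WicketTuple n) : Fin n → ℝ := fun i => wlen (f.1 i)

lemma continuous_tops {n : ℕ} : Continuous (tops (n := n)) :=
  continuous_pi fun i =>
    continuous_topPt.comp ((continuous_apply i).comp continuous_subtype_val)

lemma continuous_wlens {n : ℕ} : Continuous (wlens (n := n)) :=
  continuous_pi fun i =>
    continuous_wlen.comp ((continuous_apply i).comp continuous_subtype_val)

lemma tops_injective {n : ℕ} {f : WicketTuple n} (hf : IsUWTuple f) :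
    Function.Injective (tops f) := by
  intro i j hij
  by_contra hne
  have hm : ∀ i, e3mk (tops f i 0) (tops f i 1) 0 ∈ wicket (f.1 i).1 (f.1 i).2 := by
    intro i
    unfold tops
    rcases topPt_mem (hf i) with e | e <;> rw [e]
    · exact left_mem_wicket _ _
    · exact right_mem_wicket _ _
  have h1 := hm i
  rw [hij] at h1
  exact Set.disjoint_left.1 (f.2.2 i j hne) h1 (hm j)

lemma tops_rel {n : ℕ} {f g : WicketTuple n}
    (h : Quotient.mk (wicketSetoid n) f = Quotient.mk (wicketSetoid n) g) (hf : IsUWTuple f) :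
    ∃ σ : Equiv.Perm (Fin n), tops g = tops f ∘ σ ∧ wlens g = wlens f ∘ σ := by
  obtain ⟨σ, hσ⟩ := rel_perm h
  refine ⟨σ, funext fun i => ?_, funext fun i => ?_⟩
  · simp only [tops, Function.comp]
    rcases hσ i with e | e <;> rw [e]
    exact topPt_swap (hf _)
  · simp only [wlens, Function.comp]
    rcases hσ i with e | e <;> rw [e]
    exact wlen_swap _

/-! ### Sigma tuples -/

structure GoodData {n : ℕ} (p : Fin n → E2) (l : Fin n → ℝ) : Prop where
  pos : ∀ i, 0 < l i
  inj : Function.Injective p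
  lt : ∀ i j, p i 0 = p j 0 → p i 1 < p j 1 → l j < p j 1 - p i 1

lemma GoodData.disjoint {n : ℕ} {p : Fin n → E2} {l : Fin n → ℝ} (h : GoodData p l)
    {i j : Fin n} (hij : i ≠ j) : Disjoint (segment ℝ (vpair (p i) (l i)).1 (vpair (p i) (l i)).2)
      (segment ℝ (vpair (p j) (l j)).1 (vpair (p j) (l j)).2) := by
  rw [Set.disjoint_left]
  intro q hi hj
  rw [mem_segment_vpair (h.pos _)] at hi hj
  have h0 : p i 0 = p j 0 := hi.1.symm.trans hj.1
  rcases lt_trichotomy (p i 1) (p j 1) with h1 | h1 | h1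
  · linarith [h.lt i j h0 h1]
  · exact hij (h.inj (E2_ext h0 h1))
  · linarith [h.lt j i h0.symm h1]

lemma vpair_ne {p : E2} {l : ℝ} (hl : 0 < l) : (vpair p l).1 ≠ (vpair p l).2 := by
  intro h
  have := congrArg (fun q : E2 => q 1) h
  simp [vpair] at this
  linarith

lemma GoodData.isWicketTuple {n : ℕ} {p : Fin n → E2} {l : Fin n → ℝ} (h : GoodData p l) :
    IsWicketTuple fun i => vpair (p i) (l i) := by
  refine ⟨fun i => vpair_ne (h.pos i), fun i j hij => ?_⟩
  rw [Set.disjoint_left]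
  intro z hi hj
  exact Set.disjoint_left.1 (h.disjoint hij) (proj_mem_segment (vpair_ne (h.pos i)) hi)
    (proj_mem_segment (vpair_ne (h.pos j)) hj)

def sigT {n : ℕ} (p : Fin n → E2) (l : Fin n → ℝ) (h : GoodData p l) : WicketTuple n :=
  ⟨fun i => vpair (p i) (l i), h.isWicketTuple⟩

lemma sigT_sigma {n : ℕ} (p : Fin n → E2) (l : Fin n → ℝ) (h : GoodData p l) :
    IsSigmaTuple (sigT p l h) :=
  ⟨fun _ => rfl, fun _ _ hij => h.disjoint hij⟩

def sigC {n : ℕ} (p : Fin n → E2) (l : Fin n → ℝ) (h : GoodData p l) : SigmaConf n :=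
  ⟨Quotient.mk (wicketSetoid n) (sigT p l h), _, rfl, sigT_sigma p l h⟩

lemma sigC_perm {n : ℕ} {p p' : Fin n → E2} {l l' : Fin n → ℝ} (h : GoodData p l)
    (h' : GoodData p' l') (σ : Equiv.Perm (Fin n)) (hp : p' = p ∘ σ) (hl : l' = l ∘ σ) :
    sigC p l h = sigC p' l' h' := by
  subst hp hl
  exact Subtype.ext (rel_of_perm σ fun i => Or.inl rfl)

lemma continuous_sigC {n : ℕ} {X : Type*} [TopologicalSpace X] {p : X → Fin n → E2}
    {l : X → Fin n → ℝ} (h : ∀ x, GoodData (p x) (l x)) (hp : Continuous p)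
    (hl : Continuous l) : Continuous fun x => sigC (p x) (l x) (h x) := by
  refine Continuous.subtype_mk (continuous_quotient_mk'.comp ?_) _
  refine Continuous.subtype_mk (continuous_pi fun i => ?_) _
  have hpi : Continuous fun x => p x i := (continuous_apply i).comp hp
  have hli : Continuous fun x => l x i := (continuous_apply i).comp hl
  unfold vpair
  refine hpi.prodMk (continuous_mk2 ?_ ?_) <;> fun_prop

lemma good_of_sigma {n : ℕ} {f : WicketTuple n} (hf : IsSigmaTuple f) :
    GoodData (tops f) (wlens f) := by
  refine ⟨fun i => wlen_pos (hf.1 i) (f.2.1 i), tops_injective hf.1, fun i j h0 h1 => ?_⟩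
  by_contra hn
  have hne : i ≠ j := by rintro rfl; exact lt_irrefl _ h1
  have hs : ∀ i, segment ℝ (f.1 i).1 (f.1 i).2 =
      segment ℝ (vpair (tops f i) (wlens f i)).1 (vpair (tops f i) (wlens f i)).2 := by
    intro i
    rcases pair_nf (hf.1 i) with e | e
    · conv_lhs => rw [e]
      rfl
    · conv_lhs => rw [e]
      exact segment_symm _ _ _
  have hd := hf.2 i j hne
  rw [hs, hs] at hd
  have hd' : ∀ q, q ∈ segment ℝ (vpair (tops f i) (wlens f i)).1 (vpair (tops f i) (wlens f i)).2 →
      q ∉ segment ℝ (vpair (tops f j) (wlens f j)).1 (vpair (tops f j) (wlens f j)).2 :=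
    fun q hq => Set.disjoint_left.1 hd hq
  refine hd' (tops f i) ?_ ?_
  · exact left_mem_segment _ _ _
  · have hp : 0 < wlens f j := wlen_pos (hf.1 j) (f.2.1 j)
    rw [mem_segment_vpair hp]
    exact ⟨h0, by linarith, h1.le⟩

lemma sigC_self {n : ℕ} {f : WicketTuple n} (hf : IsSigmaTuple f) :
    (sigC (tops f) (wlens f) (good_of_sigma hf)).1 = Quotient.mk (wicketSetoid n) f :=
  rel_of_perm 1 fun i => pair_nf (hf.1 i)

/-- A common length, small compared with all distances. -/
def ell {n : ℕ} (p : Fin n → E2) : ℝ := (1 + ∑ i, ∑ j, (dist (p i) (p j))⁻¹)⁻¹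

lemma ell_pos {n : ℕ} (p : Fin n → E2) : 0 < ell p := by
  unfold ell; positivity

lemma ell_perm {n : ℕ} (p : Fin n → E2) (σ : Equiv.Perm (Fin n)) : ell (p ∘ σ) = ell p := by
  unfold ell
  congr 2
  rw [← Equiv.sum_comp σ fun i => ∑ j, (dist (p i) (p j))⁻¹]
  refine Finset.sum_congr rfl fun i _ => ?_
  rw [← Equiv.sum_comp σ fun j => (dist (p (σ i)) (p j))⁻¹]
  rfl

lemma ell_lt {n : ℕ} (p : Fin n → E2) {i j : Fin n} (h : p i ≠ p j) :
    ell p < dist (p i) (p j) := by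
  have hd : 0 < dist (p i) (p j) := dist_pos.2 h
  have h0 : ∀ a b, 0 ≤ (dist (p a) (p b))⁻¹ := fun a b => inv_nonneg.2 dist_nonneg
  have h1 : (dist (p i) (p j))⁻¹ ≤ ∑ j, (dist (p i) (p j))⁻¹ :=
    Finset.single_le_sum (f := fun j => (dist (p i) (p j))⁻¹) (fun b _ => h0 i b)
      (Finset.mem_univ j)
  have h2 : ∑ j, (dist (p i) (p j))⁻¹ ≤ ∑ i, ∑ j, (dist (p i) (p j))⁻¹ :=
    Finset.single_le_sum (f := fun i => ∑ j, (dist (p i) (p j))⁻¹)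
      (fun a _ => Finset.sum_nonneg fun b _ => h0 a b) (Finset.mem_univ i)
  have h3 : (dist (p i) (p j))⁻¹ < 1 + ∑ i, ∑ j, (dist (p i) (p j))⁻¹ := by linarith
  have h4 := inv_strictAnti₀ (inv_pos.2 hd) h3
  rwa [inv_inv] at h4

lemma continuous_ell {n : ℕ} {X : Type*} [TopologicalSpace X] {p : X → Fin n → E2}
    (hp : Continuous p) (hinj : ∀ x, Function.Injective (p x)) :
    Continuous fun x => ell (p x) := by
  unfold ell
  refine Continuous.inv₀ (continuous_const.add ?_) fun x => by positivity
  refine continuous_finsetSum _ fun i _ => continuous_finsetSum _ fun j _ => ?_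
  by_cases hij : i = j
  · subst hij
    simpa using continuous_const
  · refine Continuous.inv₀ ?_ fun x => (dist_pos.2 fun h => hij (hinj x h)).ne'
    exact ((continuous_apply i).comp hp).dist ((continuous_apply j).comp hp)

lemma good_ell {n : ℕ} {p : Fin n → E2} (hp : Function.Injective p) :
    GoodData p fun _ => ell p := by
  refine ⟨fun _ => ell_pos p, hp, fun i j h0 h1 => ?_⟩
  have hne : p j ≠ p i := fun h => by rw [h] at h1; exact lt_irrefl _ h1
  have h2 := ell_lt p hne
  rw [EuclideanSpace.dist_eq, Fin.sum_univ_two, h0, Real.dist_eq, Real.dist_eq, sub_self] at h2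
  simpa [Real.sqrt_sq_eq_abs, abs_of_pos (sub_pos.2 h1)] using h2

lemma GoodData.convex {n : ℕ} {p : Fin n → E2} {l l' : Fin n → ℝ} (h : GoodData p l)
    (h' : GoodData p l') (t : unitInterval) :
    GoodData p fun i => (1 - (t : ℝ)) * l' i + t * l i := by
  have ht0 := t.2.1
  have ht1 := t.2.2
  have key : ∀ a b c d : ℝ, a < c → b < c → (1 - (t : ℝ)) * b + t * a < c := by
    intro a b c d ha hb
    rcases ht0.eq_or_lt with e | e
    · rw [← e]; linarith
    · nlinarith
  refine ⟨fun i => ?_, h.inj, fun i j h0 h1 => key _ _ _ 0 (h.lt i j h0 h1) (h'.lt i j h0 h1)⟩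
  have := key (-l i) (-l' i) 0 0 (by linarith [h.pos i]) (by linarith [h'.pos i])
  linarith

/-! ### Rho tuples -/

lemma mem_rho_wicket {p : E2} (hp : 0 < p 1) (z : E3) :
    z ∈ wicket (vpair p (2 * p 1)).1 (vpair p (2 * p 1)).2 ↔
      0 ≤ z 2 ∧ z 0 = p 0 ∧ (z 1) ^ 2 + (z 2) ^ 2 = (p 1) ^ 2 := by
  rw [mem_wicket_iff]
  simp only [vpair, mk2_zero, mk2_one]
  constructor
  · rintro ⟨h2, h, t, h0, h1⟩
    have h0' : z 0 = p 0 := by rw [h0]; ring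
    refine ⟨h2, h0', ?_⟩
    rw [h0'] at h
    linarith
  · rintro ⟨h2, h0, h⟩
    refine ⟨h2, ?_, (p 1 - z 1) / (2 * p 1), ?_, ?_⟩
    · rw [h0]; linarith
    · rw [h0]; ring
    · field_simp; ring

structure RhoData {n : ℕ} (p : Fin n → E2) : Prop where
  pos : ∀ i, 0 < p i 1
  inj : Function.Injective p

lemma RhoData.isWicketTuple {n : ℕ} {p : Fin n → E2} (h : RhoData p) :
    IsWicketTuple fun i => vpair (p i) (2 * p i 1) := by
  refine ⟨fun i => vpair_ne (by linarith [h.pos i]), fun i j hij => ?_⟩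
  rw [Set.disjoint_left]
  intro z hi hj
  rw [mem_rho_wicket (h.pos _)] at hi hj
  refine hij (h.inj (E2_ext (hi.2.1.symm.trans hj.2.1) ?_))
  have h2 : (p i 1) ^ 2 = (p j 1) ^ 2 := hi.2.2.symm.trans hj.2.2
  exact (pow_left_inj₀ (h.pos i).le (h.pos j).le two_ne_zero).1 h2

def rhoT {n : ℕ} (p : Fin n → E2) (h : RhoData p) : WicketTuple n :=
  ⟨fun i => vpair (p i) (2 * p i 1), h.isWicketTuple⟩

lemma rhoT_rho {n : ℕ} (p : Fin n → E2) (h : RhoData p) : IsRhoTuple (rhoT p h) := by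
  refine ⟨fun _ => rfl, fun i => ?_⟩
  have key : ∀ z, z ∈ wicket ((rhoT p h).1 i).1 ((rhoT p h).1 i).2 →
      reflXZ z ∈ wicket ((rhoT p h).1 i).1 ((rhoT p h).1 i).2 := by
    intro z hz
    have hz' := (mem_rho_wicket (h.pos i) z).1 hz
    refine (mem_rho_wicket (h.pos i) _).2 ?_
    simpa [reflXZ] using hz'
  have hinv : ∀ z, reflXZ (reflXZ z) = z := by
    intro z
    refine E3_ext ?_ ?_ ?_ <;> simp [reflXZ]
  ext z
  constructor
  · rintro ⟨w, hw, rfl⟩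
    exact key w hw
  · intro hz
    exact ⟨reflXZ z, key z hz, hinv z⟩

def rhoC {n : ℕ} (p : Fin n → E2) (h : RhoData p) : RhoConf n :=
  ⟨Quotient.mk (wicketSetoid n) (rhoT p h), _, rfl, rhoT_rho p h⟩

lemma rhoC_perm {n : ℕ} {p p' : Fin n → E2} (h : RhoData p)
    (h' : RhoData p') (σ : Equiv.Perm (Fin n)) (hp : p' = p ∘ σ) :
    rhoC p h = rhoC p' h' := by
  subst hp
  exact Subtype.ext (rel_of_perm σ fun i => Or.inl rfl)

lemma continuous_rhoC {n : ℕ} {X : Type*} [TopologicalSpace X] {p : X → Fin n → E2}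
    (h : ∀ x, RhoData (p x)) (hp : Continuous p) :
    Continuous fun x => rhoC (p x) (h x) := by
  refine Continuous.subtype_mk (continuous_quotient_mk'.comp ?_) _
  refine Continuous.subtype_mk (continuous_pi fun i => ?_) _
  have hpi : Continuous fun x => p x i := (continuous_apply i).comp hp
  unfold vpair
  refine hpi.prodMk (continuous_mk2 ?_ ?_) <;> fun_prop

lemma rho_pair {n : ℕ} {f : WicketTuple n} (hf : IsRhoTuple f) (i : Fin n) :
    0 < tops f i 1 ∧ wlens f i = 2 * tops f i 1 := by
  have h0 := hf.1 i
  have hr := hf.2 i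
  have hne := f.2.1 i
  simp only [tops, wlens, topPt, wlen, mk2_one]
  generalize (f.1 i) = e at *
  obtain ⟨a, b⟩ := e
  simp only at *
  have key : ∀ c : E2, e3mk (c 0) (c 1) 0 ∈ wicket a b → mk2 (c 0) (-(c 1)) = a ∨
      mk2 (c 0) (-(c 1)) = b := by
    intro c hc
    apply eq_of_floor_mem
    rw [← hr]
    exact ⟨_, hc, rfl⟩
  have ha : -(a 1) = a 1 ∨ -(a 1) = b 1 := by
    rcases key a (left_mem_wicket _ _) with h | h
    · left; exact congrArg (fun q : E2 => q 1) h
    · right; exact congrArg (fun q : E2 => q 1) h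
  have hb : -(b 1) = a 1 ∨ -(b 1) = b 1 := by
    rcases key b (right_mem_wicket _ _) with h | h
    · left; exact congrArg (fun q : E2 => q 1) h
    · right; exact congrArg (fun q : E2 => q 1) h
  have hab : a 1 ≠ b 1 := fun h => hne (E2_ext h0 h)
  have hs : b 1 = -(a 1) := by
    rcases ha with h | h
    · rcases hb with h' | h'
      · linarith
      · exact absurd (by linarith) hab
    · exact h.symm
  rw [hs] at hab ⊢
  rcases lt_trichotomy (a 1) 0 with h | h | h
  · rw [max_eq_right (by linarith), abs_of_neg (by linarith)]
    constructor <;> linarith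
  · exact absurd (by linarith) hab
  · rw [max_eq_left (by linarith), abs_of_pos (by linarith)]
    constructor <;> linarith

lemma rhoData_of_rho {n : ℕ} {f : WicketTuple n} (hf : IsRhoTuple f) : RhoData (tops f) :=
  ⟨fun i => (rho_pair hf i).1, tops_injective hf.1⟩

lemma rhoC_self {n : ℕ} {f : WicketTuple n} (hf : IsRhoTuple f) :
    (rhoC (tops f) (rhoData_of_rho hf)).1 = Quotient.mk (wicketSetoid n) f := by
  refine rel_of_perm 1 fun i => ?_
  have h := pair_nf (hf.1 i)
  have h2 : wlen (f.1 i) = 2 * tops f i 1 := (rho_pair hf i).2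
  rw [h2] at h
  exact h

lemma tops_rhoT {n : ℕ} (p : Fin n → E2) (h : RhoData p) : tops (rhoT p h) = p :=
  funext fun i => topPt_vpair (by linarith [h.pos i])

lemma tops_sigT {n : ℕ} (p : Fin n → E2) (l : Fin n → ℝ) (h : GoodData p l) :
    tops (sigT p l h) = p :=
  funext fun i => topPt_vpair (h.pos i).le

/-! ### The maps -/

def ptMk {n : ℕ} (p : Fin n → E2) (h : Function.Injective p) : CConf n :=
  Quotient.mk (ptSetoid n) ⟨p, h⟩

lemma ptMk_perm {n : ℕ} {p p' : Fin n → E2} (h : Function.Injective p)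
    (h' : Function.Injective p') (σ : Equiv.Perm (Fin n)) (hp : p' = p ∘ σ) :
    ptMk p h = ptMk p' h' := by
  subst hp
  exact Quotient.sound (σ.surjective.range_comp p).symm

/-- The map sending each untwisted wicket configuration to its top endpoints. -/
lemma exists_topMap (n : ℕ) : ∃ F : C(UWConf n, CConf n), ∀ (f : WicketTuple n)
    (hf : IsUWTuple f), F ⟨Quotient.mk (wicketSetoid n) f, f, rfl, hf⟩
      = ptMk (tops f) (tops_injective hf) := by
  obtain ⟨F, hF⟩ := exists_lift' (UWConf n)
    (fun f => ptMk (tops f.1) (tops_injective (uw_of_mem f.2)))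
    (continuous_quotient_mk'.comp (Continuous.subtype_mk
      (continuous_tops.comp continuous_subtype_val) _))
    (fun f g h => by
      obtain ⟨σ, hσ, -⟩ := tops_rel h (uw_of_mem f.2)
      exact ptMk_perm _ _ σ hσ)
  exact ⟨F, fun f hf => hF ⟨f, f, rfl, hf⟩⟩

lemma exists_sigMap (n : ℕ) : ∃ G : C(CConf n, SigmaConf n), ∀ (p : Fin n → E2)
    (hp : Function.Injective p), G (ptMk p hp) = sigC p (fun _ => ell p) (good_ell hp) := by
  let G0 : PtTuple n → SigmaConf n := fun p => sigC p.1 (fun _ => ell p.1) (good_ell p.2)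
  have hG0 : Continuous G0 :=
    continuous_sigC _ continuous_subtype_val
      (continuous_pi fun _ => continuous_ell continuous_subtype_val fun p => p.2)
  have hG1 : ∀ p q : PtTuple n, (ptSetoid n).r p q → G0 p = G0 q := by
    intro p q h
    obtain ⟨σ, hσ⟩ := exists_perm p.2 q.2 h
    have hσ' : q.1 = p.1 ∘ σ := funext hσ
    refine sigC_perm _ _ σ hσ' ?_
    funext _
    simp only [hσ', ell_perm, Function.comp]
  exact ⟨⟨Quotient.lift G0 hG1, hG0.quotient_lift hG1⟩, fun p hp => rfl⟩

lemma exists_sigma_homotopy (n : ℕ) : ∃ H : C(unitInterval × SigmaConf n, SigmaConf n),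
    ∀ (f : WicketTuple n) (hf : IsSigmaTuple f),
      H (0, ⟨Quotient.mk (wicketSetoid n) f, f, rfl, hf⟩)
        = sigC (tops f) (fun _ => ell (tops f)) (good_ell (tops_injective hf.1)) ∧
      H (1, ⟨Quotient.mk (wicketSetoid n) f, f, rfl, hf⟩)
        = ⟨Quotient.mk (wicketSetoid n) f, f, rfl, hf⟩ := by
  have ct : Continuous fun x : unitInterval × (Quotient.mk (wicketSetoid n) ⁻¹' SigmaConf n) =>
      tops x.2.1 := continuous_tops.comp (continuous_subtype_val.comp continuous_snd)
  obtain ⟨H, hH⟩ := exists_lift (SigmaConf n) (K := unitInterval)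
    (fun x => sigC (tops x.2.1) _ ((good_of_sigma (sigma_of_mem x.2.2)).convex
      (good_ell (tops_injective (sigma_of_mem x.2.2).1)) x.1))
    (by
      refine continuous_sigC _ ct (continuous_pi fun i => ?_)
      have h1 := continuous_ell ct fun x => tops_injective (sigma_of_mem x.2.2).1
      have h2 : Continuous fun x : unitInterval ×
          (Quotient.mk (wicketSetoid n) ⁻¹' SigmaConf n) => wlens x.2.1 i :=
        (continuous_apply i).comp
          (continuous_wlens.comp (continuous_subtype_val.comp continuous_snd))
      have h3 : Continuous fun x : unitInterval ×
          (Quotient.mk (wicketSetoid n) ⁻¹' SigmaConf n) => (x.1 : ℝ) :=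
        continuous_subtype_val.comp continuous_fst
      exact ((continuous_const.sub h3).mul h1).add (h3.mul h2))
    (fun k f g h => by
      obtain ⟨σ, hσ, hl⟩ := tops_rel h (sigma_of_mem f.2).1
      refine sigC_perm _ _ σ hσ ?_
      funext i
      simp only [hσ, hl, ell_perm, Function.comp])
  refine ⟨H, fun f hf => ⟨?_, ?_⟩⟩
  · rw [hH 0 ⟨f, f, rfl, hf⟩]
    refine sigC_perm _ _ 1 rfl ?_
    funext i; simp
  · rw [hH 1 ⟨f, f, rfl, hf⟩]
    refine Eq.trans (sigC_perm _ (good_of_sigma hf) 1 rfl ?_) (Subtype.ext (sigC_self hf))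
    funext i; simp

lemma rhoData_mix {n : ℕ} {p : Fin n → E2} (t : unitInterval) (ht : t = 0 ∨ ∀ i, 0 < p i 1)
    (hp : Function.Injective p) :
    RhoData fun i => mk2 (p i 0) ((1 - (t : ℝ)) * Real.exp (p i 1) + t * p i 1) := by
  have ht0 := t.2.1
  have ht1 := t.2.2
  refine ⟨fun i => ?_, fun i j hij => hp (E2_ext ?_ ?_)⟩
  · simp only [mk2_one]
    rcases ht with rfl | h
    · simpa using Real.exp_pos _
    · have h1 := h i
      have h2 := Real.exp_pos (p i 1)
      rcases ht0.eq_or_lt with e | e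
      · rw [← e]; linarith
      · have : 0 ≤ (1 - (t : ℝ)) * Real.exp (p i 1) := mul_nonneg (by linarith) h2.le
        have := mul_pos e h1
        linarith
  · have h : mk2 _ _ 0 = mk2 _ _ 0 := congrArg (fun q : E2 => q 0) hij
    exact h
  · have h : (1 - (t : ℝ)) * Real.exp (p i 1) + t * p i 1 =
        (1 - (t : ℝ)) * Real.exp (p j 1) + t * p j 1 := congrArg (fun q : E2 => q 1) hij
    have key : ∀ a b : ℝ, a < b → (1 - (t : ℝ)) * Real.exp a + t * a <
        (1 - (t : ℝ)) * Real.exp b + t * b := by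
      intro a b hab
      have he := Real.exp_lt_exp.2 hab
      rcases ht0.eq_or_lt with e | e
      · rw [← e]; linarith
      · have h1 : (1 - (t : ℝ)) * Real.exp a ≤ (1 - (t : ℝ)) * Real.exp b :=
          mul_le_mul_of_nonneg_left he.le (by linarith)
        have h2 := mul_lt_mul_of_pos_left hab e
        linarith
    rcases lt_trichotomy (p i 1) (p j 1) with h' | h' | h'
    · exact absurd h (key _ _ h').ne
    · exact h'
    · exact absurd h (key _ _ h').ne'

lemma continuous_mix {X : Type*} [TopologicalSpace X] {p : X → E2} {t : X → unitInterval}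
    (hp : Continuous p) (ht : Continuous t) : Continuous fun x =>
      mk2 (p x 0) ((1 - (t x : ℝ)) * Real.exp (p x 1) + t x * p x 1) := by
  have h0 : Continuous fun x => p x 0 := by fun_prop
  have h1 : Continuous fun x => p x 1 := by fun_prop
  have h2 : Continuous fun x => (t x : ℝ) := continuous_subtype_val.comp ht
  exact continuous_mk2 h0
    (((continuous_const.sub h2).mul (Real.continuous_exp.comp h1)).add (h2.mul h1))

/-- The map from untwisted configurations to symmetric ones. -/
lemma exists_rhoMap (n : ℕ) : ∃ T : C(UWConf n, RhoConf n), ∀ (f : WicketTuple n)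
    (hf : IsUWTuple f), T ⟨Quotient.mk (wicketSetoid n) f, f, rfl, hf⟩
      = rhoC _ (rhoData_mix 0 (Or.inl rfl) (tops_injective hf)) := by
  obtain ⟨F, hF⟩ := exists_lift' (UWConf n)
    (fun f => rhoC _ (rhoData_mix 0 (Or.inl rfl) (tops_injective (uw_of_mem f.2))))
    (by
      refine continuous_rhoC _ (continuous_pi fun i => ?_)
      have h2 : Continuous fun x : (Quotient.mk (wicketSetoid n) ⁻¹' UWConf n) =>
          tops x.1 i :=
        (continuous_apply i).comp (continuous_tops.comp continuous_subtype_val)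
      exact continuous_mix h2 continuous_const)
    (fun f g h => by
      obtain ⟨σ, hσ, -⟩ := tops_rel h (uw_of_mem f.2)
      refine rhoC_perm _ _ σ ?_
      funext i
      simp only [hσ, Function.comp])
  exact ⟨F, fun f hf => hF ⟨f, f, rfl, hf⟩⟩

lemma exists_rho_homotopy (n : ℕ) : ∃ H : C(unitInterval × RhoConf n, RhoConf n),
    ∀ (f : WicketTuple n) (hf : IsRhoTuple f),
      H (0, ⟨Quotient.mk (wicketSetoid n) f, f, rfl, hf⟩)
        = rhoC _ (rhoData_mix 0 (Or.inl rfl) (tops_injective hf.1)) ∧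
      H (1, ⟨Quotient.mk (wicketSetoid n) f, f, rfl, hf⟩)
        = ⟨Quotient.mk (wicketSetoid n) f, f, rfl, hf⟩ := by
  obtain ⟨H, hH⟩ := exists_lift (RhoConf n) (K := unitInterval)
    (fun x => rhoC _ (rhoData_mix x.1 (Or.inr (rhoData_of_rho (rho_of_mem x.2.2)).pos)
      (tops_injective (rho_of_mem x.2.2).1)))
    (by
      refine continuous_rhoC _ (continuous_pi fun i => ?_)
      have h2 : Continuous fun x : unitInterval ×
          (Quotient.mk (wicketSetoid n) ⁻¹' RhoConf n) => tops x.2.1 i :=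
        (continuous_apply i).comp
          (continuous_tops.comp (continuous_subtype_val.comp continuous_snd))
      exact continuous_mix h2 continuous_fst)
    (fun k f g h => by
      obtain ⟨σ, hσ, -⟩ := tops_rel h (rho_of_mem f.2).1
      refine rhoC_perm _ _ σ ?_
      funext i
      simp only [hσ, Function.comp])
  refine ⟨H, fun f hf => ⟨hH 0 ⟨f, f, rfl, hf⟩, ?_⟩⟩
  rw [hH 1 ⟨f, f, rfl, hf⟩]
  refine Eq.trans (rhoC_perm _ (rhoData_of_rho hf) 1 ?_) (Subtype.ext (rhoC_self hf))
  funext i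
  exact E2_ext (by simp) (by simp)

lemma rho_homeo (n : ℕ) : Nonempty (↥(RhoConf n) ≃ₜ HConf n) := by
  let A0 : (Quotient.mk (wicketSetoid n) ⁻¹' RhoConf n) → HConf n := fun f =>
    Quotient.mk (hptSetoid n) ⟨fun i => ⟨tops f.1 i, (rhoData_of_rho (rho_of_mem f.2)).pos i⟩,
      fun i j h => tops_injective (rho_of_mem f.2).1 (congrArg Subtype.val h)⟩
  obtain ⟨A, hA⟩ := exists_lift' (RhoConf n) A0
    (by
      refine continuous_quotient_mk'.comp (Continuous.subtype_mk (continuous_pi fun i => ?_) _)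
      refine Continuous.subtype_mk ?_ _
      exact (continuous_apply i).comp (continuous_tops.comp continuous_subtype_val))
    (fun f g h => by
      obtain ⟨σ, hσ, -⟩ := tops_rel h (rho_of_mem f.2).1
      apply Quotient.sound
      change Set.range _ = Set.range _
      rw [← σ.surjective.range_comp]
      congr 1
      funext i
      apply Subtype.ext
      simp only [hσ, Function.comp])
  have hd : ∀ p : HPtTuple n, RhoData fun i => (p.1 i).1 := fun p =>
    ⟨fun i => (p.1 i).2, fun i j h => p.2 (Subtype.ext h)⟩
  let B0 : HPtTuple n → RhoConf n := fun p => rhoC _ (hd p)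
  have hB0 : Continuous B0 := by
    refine continuous_rhoC _ (continuous_pi fun i => ?_)
    exact continuous_subtype_val.comp ((continuous_apply i).comp continuous_subtype_val)
  have hB1 : ∀ p q : HPtTuple n, (hptSetoid n).r p q → B0 p = B0 q := by
    intro p q h
    obtain ⟨σ, hσ⟩ := exists_perm p.2 q.2 h
    refine rhoC_perm _ _ σ ?_
    funext i
    simp only [hσ, Function.comp]
  refine ⟨⟨⟨A, Quotient.lift B0 hB1, ?_, ?_⟩, A.continuous, hB0.quotient_lift hB1⟩⟩
  · rintro ⟨_, f, rfl, hf⟩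
    rw [hA ⟨f, f, rfl, hf⟩]
    exact Subtype.ext (rhoC_self hf)
  · intro y
    induction y using Quotient.inductionOn with
    | h p =>
      change A (rhoC _ (hd p)) = _
      refine (hA ⟨rhoT _ (hd p), _, rfl, rhoT_rho _ (hd p)⟩).trans ?_
      refine congrArg (Quotient.mk (hptSetoid n)) (Subtype.ext (funext fun i => Subtype.ext ?_))
      exact congrFun (tops_rhoT _ (hd p)) i

/-- (1) The map `𝒰𝒲^σ_n → 𝒞_n` sending each wicket to its endpoint of larger
`y`-coordinate is a homotopy equivalence; (2) `𝒰𝒲^ρ_n` is homeomorphic to the unordered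
configuration space of `n` points in the open upper half-plane; (3) the inclusions
`𝒰𝒲^σ_n ↪ 𝒰𝒲_n` and `𝒰𝒲^ρ_n ↪ 𝒰𝒲_n` induce injective homomorphisms on fundamental
groups, so `π₁𝒰𝒲_n` contains two subgroups isomorphic to the braid group `B_n`. -/
theorem statement9 (n : ℕ) :
    (∃ F : C(↥(SigmaConf n), CConf n),
      (∀ f : WicketTuple n, IsSigmaTuple f → ∀ g : PtTuple n,
        g.1 = (fun i => if (f.1 i).2 1 < (f.1 i).1 1 then (f.1 i).1 else (f.1 i).2) →
        ∀ x : ↥(SigmaConf n), x.1 = Quotient.mk (wicketSetoid n) f →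
          F x = Quotient.mk (ptSetoid n) g) ∧
      ∃ h : ContinuousMap.HomotopyEquiv (↥(SigmaConf n)) (CConf n), h.toFun = F) ∧
    Nonempty (↥(RhoConf n) ≃ₜ HConf n) ∧
    (∀ x : ↥(SigmaConf n), Function.Injective (pi1Map (inclSigma n) x)) ∧
    (∀ x : ↥(RhoConf n), Function.Injective (pi1Map (inclRho n) x)) := by
  obtain ⟨F, hF⟩ := exists_topMap n
  obtain ⟨G, hG⟩ := exists_sigMap n
  obtain ⟨H, hH⟩ := exists_sigma_homotopy n
  obtain ⟨T, hT⟩ := exists_rhoMap n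
  obtain ⟨R, hR⟩ := exists_rho_homotopy n
  have hFs : ∀ (f : WicketTuple n) (hf : IsSigmaTuple f),
      (F.comp (inclSigma n)) ⟨Quotient.mk (wicketSetoid n) f, f, rfl, hf⟩
        = ptMk (tops f) (tops_injective hf.1) := fun f hf => hF f hf.1
  have hleft : (G.comp (F.comp (inclSigma n))).Homotopic (ContinuousMap.id _) := by
    refine ⟨⟨H, ?_, ?_⟩⟩
    · rintro ⟨_, f, rfl, hf⟩
      refine (hH f hf).1.trans ?_
      rw [ContinuousMap.comp_apply, hFs f hf, hG]
    · rintro ⟨_, f, rfl, hf⟩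
      exact (hH f hf).2
  refine ⟨⟨F.comp (inclSigma n), ?_, ⟨F.comp (inclSigma n), G, hleft, ?_⟩, rfl⟩, rho_homeo n,
    ?_, ?_⟩
  · rintro f hf g hg ⟨x, hx⟩ rfl
    refine (hFs f hf).trans ?_
    refine congrArg (Quotient.mk (ptSetoid n)) (Subtype.ext ?_)
    rw [hg]
    funext i
    exact topPt_eq_ite (hf.1 i)
  · have : (F.comp (inclSigma n)).comp G = ContinuousMap.id _ := by
      ext y
      induction y using Quotient.inductionOn with
      | h p =>
        change (F.comp (inclSigma n)) (G (ptMk p.1 p.2)) = ptMk p.1 p.2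
        rw [hG]
        refine (hFs _ (sigT_sigma _ _ (good_ell p.2))).trans ?_
        exact ptMk_perm _ _ 1 (tops_sigT _ _ _).symm
    rw [this]
  · intro x
    exact pi1Map_injective_of_homotopic (inclSigma n) (G.comp F) hleft x
  · intro x
    refine pi1Map_injective_of_homotopic (inclRho n) T ⟨⟨R, ?_, ?_⟩⟩ x
    · rintro ⟨_, f, rfl, hf⟩
      exact (hR f hf).1.trans (hT f hf.1).symm
    · rintro ⟨_, f, rfl, hf⟩
      exact (hR f hf).2
end
end
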